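/- arXiv:1408.3336 — 2 statements merged into one kernel-verified Lean document; each statement's English description precedes it below -/
import Mathlib

section
/- Let g = Σ_β g_β X^β ∈ R[X₁,…,Xₙ] be a polynomial not all of whose coefficients lie in πR (i.e. g ∉ πR[X₁,…,Xₙ]), and set d := max{|β| : |g_β| = 1} (the total degree of the reduction of g modulo π). Then for every integer c > totalDegree(g) and every multi-index α ∈ ℕⁿ one has sup_β |g_β| · |π|^{⌊(|α|+d)/c⌋ − ⌊(|α|+|β|)/c⌋} = 1 (the supremum taken over the support of g). Equivalently, |π^{⌊(|α|+d)/c⌋} X^α g|_c = 1. -/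
open Filter

/-- If every nonzero norm is an integral power of `‖π‖`, then norms below `1` are at most `‖π‖`. -/
theorem norm_le_norm_uniformizer {K : Type*} [NormedField K] {π : K} (hπ0 : π ≠ 0)
    (hπ1 : ‖π‖ < 1) (hπuni : ∀ x : K, x ≠ 0 → ∃ m : ℤ, ‖x‖ = ‖π‖ ^ m)
    {x : K} (hx : ‖x‖ < 1) : ‖x‖ ≤ ‖π‖ := by
  have hpos : 0 < ‖π‖ := norm_pos_iff.mpr hπ0
  rcases eq_or_ne x 0 with rfl | hx0
  · simp
  obtain ⟨m, hm⟩ := hπuni x hx0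
  rw [hm] at hx ⊢
  have hm1 : 1 ≤ m := by
    by_contra! hlt
    exact hx.not_ge (one_le_zpow_of_nonpos₀ hpos hπ1.le (by lia))
  simpa using zpow_le_zpow_right_of_le_one₀ hpos hπ1.le hm1

/-- Adding less than `c` to a numerator raises the floor of its quotient by `c` at most by one. -/
theorem Int.neg_one_le_ediv_sub_ediv {a b c : ℤ} (hc : 0 < c) (h : b ≤ a + c) :
    -1 ≤ a / c - b / c := by
  have h₁ : b / c ≤ (a + c) / c := Int.ediv_le_ediv hc h
  rw [Int.add_ediv_of_dvd_right (dvd_refl c), Int.ediv_self hc.ne'] at h₁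
  linarith

/-- Let `K` be a finite extension of `ℚ_p` with its unique absolute value
extending the `p`-adic one, `π` a uniformizer.  Let `g ∈ R[X₁,…,Xₙ]` be a polynomial with
integral coefficients, not all coefficients in `πR`, and let `d` be the maximal total degree
of a monomial whose coefficient has absolute value `1`.  Then for every `c > totalDegree g`
and every multi-index `α`, the quantity
`‖g_β‖ * ‖π‖ ^ (⌊(|α|+d)/c⌋ − ⌊(|α|+|β|)/c⌋)` has supremum (indeed maximum) `1` over the
support of `g`. -/
theorem stmt0 (p : ℕ) [Fact p.Prime] {K : Type} [NontriviallyNormedField K]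
    [Algebra ℚ_[p] K] [FiniteDimensional ℚ_[p] K]
    (hiso : ∀ x : ℚ_[p], ‖algebraMap ℚ_[p] K x‖ = ‖x‖)
    (π : K) (hπ0 : π ≠ 0) (hπ1 : ‖π‖ < 1)
    (hπuni : ∀ x : K, x ≠ 0 → ∃ m : ℤ, ‖x‖ = ‖π‖ ^ m)
    {n : ℕ} (g : MvPolynomial (Fin n) K)
    (hint : ∀ β : Fin n →₀ ℕ, ‖MvPolynomial.coeff β g‖ ≤ 1)
    (hnotπ : ¬ ∀ β : Fin n →₀ ℕ, ‖MvPolynomial.coeff β g‖ ≤ ‖π‖)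
    (d : ℕ)
    (hd : IsGreatest {m : ℕ | ∃ β : Fin n →₀ ℕ,
        ‖MvPolynomial.coeff β g‖ = 1 ∧ (∑ i, β i) = m} d)
    (c : ℕ) (hc : g.totalDegree < c) (α : Fin n →₀ ℕ) :
    IsGreatest
      {x : ℝ | ∃ β ∈ g.support, x = ‖MvPolynomial.coeff β g‖ *
        ‖π‖ ^ ((((∑ i, α i) + d : ℕ) : ℤ) / (c : ℤ)
               - (((∑ i, α i) + ∑ i, β i : ℕ) : ℤ) / (c : ℤ))} 1 := by
  have hpos : 0 < ‖π‖ := norm_pos_iff.mpr hπ0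
  have hc0 : (0 : ℤ) < c := by lia
  obtain ⟨⟨β₀, hβ₀, hdeg⟩, hmax⟩ := hd
  refine ⟨⟨β₀, ?_, ?_⟩, ?_⟩
  · rw [MvPolynomial.mem_support_iff, ← norm_ne_zero_iff, hβ₀]
    exact one_ne_zero
  · simp [hβ₀, hdeg]
  rintro x ⟨β, hβ, rfl⟩
  have hβc : ∑ i, β i < c := by
    have hle := MvPolynomial.le_totalDegree hβ
    rw [Finsupp.sum_fintype _ _ fun _ ↦ rfl] at hle
    exact hle.trans_lt hc
  rcases (hint β).eq_or_lt with h1 | h1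
  · have hβd : ∑ i, β i ≤ d := hmax ⟨β, h1, rfl⟩
    rw [h1, one_mul]
    exact zpow_le_one₀ hpos hπ1.le (sub_nonneg.mpr (Int.ediv_le_ediv hc0 (by lia)))
  · calc _ ≤ ‖π‖ * ‖π‖ ^ (-1 : ℤ) := mul_le_mul
          (norm_le_norm_uniformizer hπ0 hπ1 hπuni h1)
          (zpow_le_zpow_right_of_le_one₀ hpos hπ1.le
            (Int.neg_one_le_ediv_sub_ediv hc0 (by lia)))
          (zpow_nonneg hpos.le _) hpos.le
      _ = 1 := by rw [zpow_neg_one, mul_inv_cancel₀ hpos.ne']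
end

section
/- Let p be a prime, m ≥ 1, and (i₁,…,i_m) ∈ ℕ^m with i₁ + 2i₂ + ⋯ + m·i_m = m. Then Σ_{j=1}^m ( v_p(i_j!) + i_j · v_p(j) ) ≤ 2m, where v_p denotes the p-adic valuation of a positive integer. Equivalently, v_p(i₁!·i₂!⋯i_m! · 1^{i₁}·2^{i₂}⋯m^{i_m}) ≤ 2m. -/
/-- Let `p` be a prime, `m ≥ 1`, and `(i₁,…,i_m) ∈ ℕ^m` with
`i₁ + 2i₂ + ⋯ + m·i_m = m`.  Then
`Σ_{j=1}^m (v_p(i_j!) + i_j · v_p(j)) ≤ 2m`, i.e.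
`v_p(i₁!⋯i_m! · 1^{i₁} 2^{i₂} ⋯ m^{i_m}) ≤ 2m`. -/
theorem stmt9 (p : ℕ) (hp : p.Prime) (m : ℕ) (hm : 1 ≤ m)
    (i : Fin m → ℕ) (h : ∑ j : Fin m, ((j : ℕ) + 1) * i j = m) :
    ∑ j : Fin m, (padicValNat p (Nat.factorial (i j)) + i j * padicValNat p ((j : ℕ) + 1))
      ≤ 2 * m := by
  have : Fact p.Prime := ⟨hp⟩
  calc ∑ j : Fin m, (padicValNat p (Nat.factorial (i j)) + i j * padicValNat p ((j : ℕ) + 1))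
      ≤ ∑ j : Fin m, 2 * (((j : ℕ) + 1) * i j) := by
        refine Finset.sum_le_sum fun j _ => ?_
        have hfac : padicValNat p (Nat.factorial (i j)) ≤ i j := padicValNat_factorial_le p (i j)
        have hval : padicValNat p ((j : ℕ) + 1) ≤ (j : ℕ) + 1 :=
          (padicValNat_le_nat_log _).trans (Nat.log_le_self _ _)
        nlinarith [Nat.mul_le_mul_left (i j) hval, Nat.zero_le ((j : ℕ) * i j)]
    _ = 2 * m := by rw [← Finset.mul_sum, h]
end
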